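/- Let U ⊆ A_d be a base-point-free monomial subspace of codimension 2. Then: (i) if d = 2, codim U² ≤ 6; (ii) if d ∈ {3, 4}, codim U² ≤ 4; (iii) if d ≥ 5, codim U² ≤ 2. -/

import Mathlib

open MvPolynomial Module

noncomputable section

abbrev PolyR (n : ℕ) := MvPolynomial (Fin n) ℂ

def formSpace (n d : ℕ) : Submodule ℂ (PolyR n) :=
  homogeneousSubmodule (Fin n) ℂ d

/-- Codimension of a subspace `U` inside the space of degree-`d` forms. -/
def vcodim (n d : ℕ) (U : Submodule ℂ (PolyR n)) : ℕ :=
  finrank ℂ (formSpace n d) - finrank ℂ U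

/-- `U` is base-point-free: the only common zero of its members in `ℂⁿ` is `0`. -/
def IsBPF (n : ℕ) (U : Submodule ℂ (PolyR n)) : Prop :=
  ∀ x : Fin n → ℂ, (∀ p ∈ U, eval x p = 0) → x = 0

/-- `m(n,d,k)`: maximum of `codim U²` over codimension-`k` subspaces `U ⊆ A(n)_d`. -/
def mMax (n d k : ℕ) : ℕ :=
  sSup { s | ∃ U : Submodule ℂ (PolyR n),
    U ≤ formSpace n d ∧ vcodim n d U = k ∧ vcodim n (2 * d) (U * U) = s }

def linForm (n : ℕ) (c : Fin n → ℂ) : PolyR n := ∑ i, c i • X i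

def colon (n d : ℕ) (U : Submodule ℂ (PolyR n)) (l : PolyR n) : Submodule ℂ (PolyR n) :=
  Submodule.comap (LinearMap.mulLeft ℂ l) U ⊓ formSpace n (d - 1)

end

/-- `U` is spanned by monomials. -/
def IsMonomialSubspace (n : ℕ) (U : Submodule ℂ (PolyR n)) : Prop :=
  ∃ S : Set (Fin n →₀ ℕ),
    U = Submodule.span ℂ ((fun α => (monomial α (1 : ℂ) : PolyR n)) '' S)

open Finset in
/-- `γ` is not a sum of two exponents of degree `d` avoiding `α`, `β`. -/
def BadExp {n : ℕ} (d : ℕ) (α β γ : Fin n →₀ ℕ) : Prop :=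
  ∀ p q : Fin n →₀ ℕ, p.degree = d → q.degree = d → p + q = γ →
    p = α ∨ p = β ∨ q = α ∨ q = β

/-- numerical condition on coordinates -/
def NumCond (d a b : ℕ) : Prop :=
  a + 1 = d ∨ (a + 2 = d ∧ b + 1 = d) ∨ (4 ≤ d ∧ a + 3 = d ∧ (b + 1 = d ∨ b + 2 = d))

lemma deg_eq_sum {n : ℕ} (f : Fin n →₀ ℕ) : f.degree = ∑ i, f i := by
  rw [Finsupp.degree_eq_sum]

lemma exists_other {n : ℕ} (f : Fin n →₀ ℕ) (i : Fin n) (h : f i < f.degree) :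
    ∃ k, k ≠ i ∧ ∃ g, f = Finsupp.single k 1 + g := by
  by_contra hcon
  push Not at hcon
  have : f.degree = f i := by
    rw [deg_eq_sum]
    apply Finset.sum_eq_single i
    · intro k _ hk
      by_contra h0
      apply hcon k hk (f - Finsupp.single k 1)
      rw [add_tsub_cancel_of_le]
      rw [Finsupp.single_le_iff]
      omega
    · simp
  omega

lemma exists_split {n : ℕ} (f : Fin n →₀ ℕ) (m : ℕ) (h : m ≤ f.degree) :
    ∃ s t, f = s + t ∧ s.degree = m := by
  induction m with
  | zero => exact ⟨0, f, by simp, by simp⟩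
  | succ m ih =>
    obtain ⟨s, t, rfl, hs⟩ := ih (by omega)
    have ht : t ≠ 0 := by
      rintro rfl
      simp at h; omega
    obtain ⟨k, hk⟩ := Finsupp.ne_iff.mp ht
    refine ⟨s + Finsupp.single k 1, t - Finsupp.single k 1, ?_, by simp [hs]⟩
    rw [add_assoc, add_tsub_cancel_of_le]
    rw [Finsupp.single_le_iff]
    simp at hk; omega

lemma three_pairs {n d : ℕ} {α β γ : Fin n →₀ ℕ} (hb : BadExp d α β γ)
    (p₁ q₁ p₂ q₂ p₃ q₃ : Fin n →₀ ℕ)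
    (hp₁ : p₁.degree = d) (hq₁ : q₁.degree = d) (h₁ : p₁ + q₁ = γ)
    (hp₂ : p₂.degree = d) (hq₂ : q₂.degree = d) (h₂ : p₂ + q₂ = γ)
    (hp₃ : p₃.degree = d) (hq₃ : q₃.degree = d) (h₃ : p₃ + q₃ = γ)
    (a₁₂ : p₁ ≠ p₂) (a₁₃ : p₁ ≠ p₃) (a₂₃ : p₂ ≠ p₃)
    (b₁₂ : p₁ ≠ q₂) (b₁₃ : p₁ ≠ q₃) (b₂₃ : p₂ ≠ q₃) : False := by
  have c₁₂ : q₁ ≠ q₂ := by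
    rintro rfl; exact a₁₂ (add_right_cancel (h₁.trans h₂.symm))
  have c₁₃ : q₁ ≠ q₃ := by
    rintro rfl; exact a₁₃ (add_right_cancel (h₁.trans h₃.symm))
  have c₂₃ : q₂ ≠ q₃ := by
    rintro rfl; exact a₂₃ (add_right_cancel (h₂.trans h₃.symm))
  have d₁₂ : q₁ ≠ p₂ := by
    rintro rfl; rw [add_comm] at h₁; exact b₁₂ (add_left_cancel (h₁.trans h₂.symm))
  have d₁₃ : q₁ ≠ p₃ := by
    rintro rfl; rw [add_comm] at h₁; exact b₁₃ (add_left_cancel (h₁.trans h₃.symm))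
  have d₂₃ : q₂ ≠ p₃ := by
    rintro rfl; rw [add_comm] at h₂; exact b₂₃ (add_left_cancel (h₂.trans h₃.symm))
  have e₁ := hb p₁ q₁ hp₁ hq₁ h₁
  have e₂ := hb p₂ q₂ hp₂ hq₂ h₂
  have e₃ := hb p₃ q₃ hp₃ hq₃ h₃
  clear hb h₁ h₂ h₃ hp₁ hp₂ hp₃ hq₁ hq₂ hq₃
  grind

lemma three_vars {n d : ℕ} {α β γ : Fin n →₀ ℕ} (hb : BadExp d α β γ)
    (x y z : Fin n) (hxy : x ≠ y) (hxz : x ≠ z) (hyz : y ≠ z) (σ τ : Fin n →₀ ℕ)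
    (hσ : σ.degree + 1 = d) (hτ : τ.degree + 2 = d)
    (hγ : γ = Finsupp.single x 1 + Finsupp.single y 1 + Finsupp.single z 1 + (σ + τ))
    (h1 : σ ≠ τ + Finsupp.single x 1) (h2 : σ ≠ τ + Finsupp.single y 1)
    (h3 : σ ≠ τ + Finsupp.single z 1) : False := by
  have inj : ∀ u v : Fin n, u ≠ v → Finsupp.single u 1 ≠ (Finsupp.single v 1 : Fin n →₀ ℕ) := by
    intro u v huv h
    have := Finsupp.single_left_injective (one_ne_zero) h
    exact huv this
  refine three_pairs hb
    (σ + Finsupp.single x 1) (τ + Finsupp.single y 1 + Finsupp.single z 1)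
    (σ + Finsupp.single y 1) (τ + Finsupp.single x 1 + Finsupp.single z 1)
    (σ + Finsupp.single z 1) (τ + Finsupp.single x 1 + Finsupp.single y 1)
    (by simp; omega) (by simp; omega) (by rw [hγ]; abel)
    (by simp; omega) (by simp; omega) (by rw [hγ]; abel)
    (by simp; omega) (by simp; omega) (by rw [hγ]; abel)
    ?_ ?_ ?_ ?_ ?_ ?_
  · intro h; exact inj _ _ hxy (add_left_cancel h)
  · intro h; exact inj _ _ hxz (add_left_cancel h)
  · intro h; exact inj _ _ hyz (add_left_cancel h)
  · intro h; apply h3; rw [add_right_comm] at h; exact add_right_cancel h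
  · intro h; apply h2; rw [add_right_comm] at h; exact add_right_cancel h
  · intro h; apply h1; exact add_right_cancel h

/-- the balanced case: `γ = x y z² τ²` -/
lemma balanced_case {n d : ℕ} {α β γ : Fin n →₀ ℕ} (hb : BadExp d α β γ)
    (x y z : Fin n) (hxy : x ≠ y) (hxz : x ≠ z) (hyz : y ≠ z) (τ : Fin n →₀ ℕ)
    (hτ : τ.degree + 2 = d) (hlt : ∀ i, γ i < d)
    (hγ : γ = Finsupp.single x 1 + Finsupp.single y 1 + Finsupp.single z 1 +
      (τ + Finsupp.single z 1 + τ)) : False := by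
  have hz : τ z < τ.degree := by
    have := hlt z
    rw [hγ] at this
    simp [Finsupp.single_apply, hxz, hyz] at this
    omega
  obtain ⟨j, hj, μ, rfl⟩ := exists_other τ z hz
  simp only [map_add, Finsupp.degree_single] at hτ
  refine three_vars hb x y z hxy hxz hyz
    (μ + Finsupp.single j 1 + Finsupp.single j 1) (μ + Finsupp.single z 1)
    (by simp; omega) (by simp; omega) (by rw [hγ]; abel) ?_ ?_ ?_
  all_goals
    intro h
    have hj' := DFunLike.congr_fun h j
    have hz' := DFunLike.congr_fun h z
    simp [Finsupp.single_apply, hj, hj.symm, hxz, hyz] at hj' hz' <;>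
    first | omega | (split_ifs at hj' <;> omega)

lemma exists_big {n d : ℕ} (hd : 2 ≤ d) {α β γ : Fin n →₀ ℕ} (hb : BadExp d α β γ)
    (hdeg : γ.degree = 2 * d) : ∃ i, d ≤ γ i := by
  by_contra hcon
  push Not at hcon
  -- three distinct variables
  have hne : γ ≠ 0 := by rintro rfl; simp at hdeg; omega
  obtain ⟨x, hx⟩ := Finsupp.ne_iff.mp hne
  obtain ⟨y, hyx, g, hg⟩ := exists_other γ x (by have := hcon x; omega)
  have hz : ∃ z, z ≠ x ∧ z ≠ y ∧ γ z ≠ 0 := by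
    by_contra hz
    push Not at hz
    have : γ.degree = γ x + γ y := by
      rw [deg_eq_sum]
      rw [← Finset.sum_pair hyx.symm]
      symm
      apply Finset.sum_subset (Finset.subset_univ _)
      intro k _ hk
      simp at hk
      exact hz k hk.1 hk.2
    have := hcon x
    have := hcon y
    omega
  obtain ⟨z, hzx, hzy, hz⟩ := hz
  have hy : γ y ≠ 0 := by rw [hg]; simp
  simp at hx
  have hle : Finsupp.single x 1 + Finsupp.single y 1 + Finsupp.single z 1 ≤ γ := by
    intro k
    simp only [Finsupp.add_apply, Finsupp.single_apply]
    split_ifs <;> first | omega | (subst_vars; first | omega | (exfalso; simp_all))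
  obtain ⟨ρ, hρ⟩ := exists_add_of_le hle
  have hρd : ρ.degree + 3 = 2 * d := by
    rw [← hdeg, hρ]; simp; omega
  obtain ⟨σ, τ, rfl, hσ⟩ := exists_split ρ (d - 1) (by omega)
  simp only [map_add] at hρd
  have hτ : τ.degree + 2 = d := by omega
  by_cases h1 : σ = τ + Finsupp.single x 1
  · exact balanced_case hb y z x hzy.symm hyx hzx τ hτ hcon (by rw [hρ, h1]; abel)
  by_cases h2 : σ = τ + Finsupp.single y 1
  · exact balanced_case hb x z y hzx.symm hyx.symm hzy τ hτ hcon (by rw [hρ, h2]; abel)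
  by_cases h3 : σ = τ + Finsupp.single z 1
  · exact balanced_case hb x y z hyx.symm hzx.symm hzy.symm τ hτ hcon (by rw [hρ, h3])
  exact three_vars hb x y z hyx.symm hzx.symm hzy.symm σ τ (by omega) hτ hρ h1 h2 h3

lemma analysis {n d : ℕ} (hd : 2 ≤ d) {α β : Fin n →₀ ℕ} (hα : α.degree = d)
    (hpα : ∀ i, α i < d) (i : Fin n)
    (hb : BadExp d α β (α + Finsupp.single i d)) :
    NumCond d (α i) (β i) ∧ (α i + 1 = d ∨ ∃ k, 1 ≤ α k ∧ 1 ≤ β k) := by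
  by_cases h1 : α i + 1 = d
  · exact ⟨Or.inl h1, Or.inl h1⟩
  have hi := hpα i
  obtain ⟨j, hj, μ, hμ⟩ := exists_other α i (by omega)
  have hμd : μ.degree + 1 = d := by rw [← hα, hμ]; simp; omega
  have hαi : α i = μ i := by rw [hμ]; simp [hj]
  have key : ∀ (j : Fin n), j ≠ i → ∀ μ : Fin n →₀ ℕ, α = Finsupp.single j 1 + μ →
      β = Finsupp.single i (d - 1) + Finsupp.single j 1 ∨ β = μ + Finsupp.single i 1 := by
    intro j hj μ hμ
    have hμd : μ.degree + 1 = d := by rw [← hα, hμ]; simp; omega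
    have hαi : α i = μ i := by rw [hμ]; simp [hj]
    have hs : (Finsupp.single i d : Fin n →₀ ℕ) =
        Finsupp.single i (d - 1) + Finsupp.single i 1 := by
      rw [← Finsupp.single_add]; congr 1; omega
    rcases hb (Finsupp.single i (d - 1) + Finsupp.single j 1) (μ + Finsupp.single i 1)
      (by rw [map_add, Finsupp.degree_single, Finsupp.degree_single]; omega)
      (by simp; omega) (by rw [hμ, hs]; abel) with h | h | h | h
    · have := DFunLike.congr_fun h i
      simp [hj] at this; omega
    · exact Or.inl h.symm
    · have := DFunLike.congr_fun h i
      simp at this; omega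
    · exact Or.inr h.symm
  have k1 := key j hj μ hμ
  have hov : ∃ k, 1 ≤ α k ∧ 1 ≤ β k := by
    rcases k1 with h | h
    · exact ⟨j, by rw [hμ]; simp, by rw [h]; simp⟩
    · have : μ ≠ 0 := by rintro rfl; simp at hμd; omega
      obtain ⟨k, hk⟩ := Finsupp.ne_iff.mp this
      simp at hk
      refine ⟨k, by rw [hμ]; simp; omega, by rw [h]; simp; omega⟩
  refine ⟨?_, Or.inr hov⟩
  have k1i : β i + 1 = d ∨ β i = α i + 1 := by
    rcases k1 with h | h
    · left; rw [h]; simp [hj]; omega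
    · right; rw [h, hαi]; simp
  by_cases h2 : α i + 2 = d
  · right; left; omega
  obtain ⟨k, hk, ν, hν⟩ := exists_other μ i (by omega)
  have hνd : ν.degree + 2 = d := by
    rw [hν] at hμd; simp at hμd; omega
  have hμi : μ i = ν i := by rw [hν]; simp [hk]
  have k2i : β i + 2 = d ∨ β i = α i + 2 := by
    have hs : (Finsupp.single i d : Fin n →₀ ℕ) =
        Finsupp.single i (d - 2) + Finsupp.single i 2 := by
      rw [← Finsupp.single_add]; congr 1; omega
    rcases hb (Finsupp.single i (d - 2) + Finsupp.single j 1 + Finsupp.single k 1)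
      (ν + Finsupp.single i 2)
      (by rw [map_add, map_add, Finsupp.degree_single, Finsupp.degree_single,
            Finsupp.degree_single]; omega)
      (by simp; omega) (by rw [hμ, hν, hs]; abel) with h | h | h | h
    · have := DFunLike.congr_fun h i
      simp [hj, hk] at this; omega
    · have := DFunLike.congr_fun h i
      simp [hj, hk] at this; omega
    · have := DFunLike.congr_fun h i
      simp at this; omega
    · have := DFunLike.congr_fun h i
      simp at this; omega
  have h3 : α i + 3 = d := by omega
  by_cases h4 : 4 ≤ d
  · right; right; omega
  exfalso
  have hd3 : d = 3 := by omega
  have hi0 : α i = 0 := by omega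
  obtain ⟨l, hl, ξ, hξ⟩ := exists_other α j (by have := hpα j; omega)
  have hli : l ≠ i := by
    rintro rfl
    rw [hξ] at hi0; simp at hi0
  have k3 := key l hli ξ hξ
  have hξi : ξ i = 0 := by rw [hξ] at hi0; simpa [hli] using hi0
  rcases k1 with h | h <;> rcases k3 with h' | h'
  · have := DFunLike.congr_fun (h.symm.trans h') l
    simp [hli, hl, hl.symm, hli.symm] at this
  · have := DFunLike.congr_fun (h.symm.trans h') i
    simp [hj, hξi] at this; omega
  · have := DFunLike.congr_fun (h.symm.trans h') i
    simp [hli] at this; omega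
  · have e : μ = ξ := add_right_cancel (h.symm.trans h')
    rw [hμ, e] at hξ
    have := add_right_cancel hξ
    exact hl (Finsupp.single_left_injective one_ne_zero this).symm

lemma BadExp.symm {n d : ℕ} {α β γ : Fin n →₀ ℕ} (h : BadExp d α β γ) : BadExp d β α γ := by
  intro p q hp hq hpq
  have := h p q hp hq hpq
  tauto

open Classical in
/-- contribution of a single index -/
noncomputable def contrib (d a b : ℕ) : ℕ :=
  (if NumCond d a b then 1 else 0) + (if NumCond d b a then 1 else 0)

/-- the numeric bound, degree at least 5 -/
lemma num5 {n d : ℕ} (hd : 5 ≤ d) (a b : Fin n → ℕ) (ha : ∑ i, a i = d) (hb : ∑ i, b i = d)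
    (ha' : ∀ i, a i < d) (hb' : ∀ i, b i < d) :
    ∑ i, contrib d (a i) (b i) ≤ 2 := by
  by_cases h : ∃ i, contrib d (a i) (b i) = 2
  · obtain ⟨i, hi⟩ := h
    rw [Finset.sum_eq_single i]
    · omega
    · intro j _ hj
      have h1 : a i + a j ≤ d := by
        rw [← ha, ← Finset.sum_pair hj.symm]
        exact Finset.sum_le_sum_of_subset (Finset.subset_univ _)
      have h2 : b i + b j ≤ d := by
        rw [← hb, ← Finset.sum_pair hj.symm]
        exact Finset.sum_le_sum_of_subset (Finset.subset_univ _)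
      unfold contrib NumCond at *
      split_ifs at hi ⊢ <;> omega
    · simp
  · push Not at h
    have : (∑ i, contrib d (a i) (b i)) * (d - 1) ≤ d + d := by
      nth_rw 3 [← ha]
      rw [← hb, ← Finset.sum_add_distrib, Finset.sum_mul]
      rw [hb]
      apply Finset.sum_le_sum
      intro i _
      have := h i
      unfold contrib NumCond at *
      split_ifs at this ⊢ <;> simp at this ⊢ <;> omega
    by_contra h3
    push Not at h3
    have : 3 * (d - 1) ≤ (∑ i, contrib d (a i) (b i)) * (d - 1) := Nat.mul_le_mul_right _ h3
    omega

lemma num34 {n d : ℕ} (hd : d = 3 ∨ d = 4) (a b : Fin n → ℕ) (ha : ∑ i, a i = d)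
    (hb : ∑ i, b i = d) (ha' : ∀ i, a i < d) (hb' : ∀ i, b i < d) :
    ∑ i, contrib d (a i) (b i) ≤ 4 := by
  have : ∑ i, contrib d (a i) (b i) * d ≤ ∑ i, (2 * a i + 2 * b i) := by
    apply Finset.sum_le_sum
    intro i _
    have := ha' i
    have := hb' i
    unfold contrib NumCond at *
    split_ifs <;> simp <;> omega
  rw [← Finset.sum_mul, Finset.sum_add_distrib, ← Finset.mul_sum, ← Finset.mul_sum, ha, hb] at this
  rcases hd with rfl | rfl <;> omega

lemma num2a {n : ℕ} (a b : Fin n → ℕ) (ha : ∑ i, a i = 2) (hb : ∑ i, b i = 2)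
    (ha' : ∀ i, a i < 2) (hb' : ∀ i, b i < 2) (j : Fin n) (hja : 1 ≤ a j) (hjb : 1 ≤ b j) :
    ∑ i, contrib 2 (a i) (b i) ≤ 6 := by
  have h1 : ∑ i, contrib 2 (a i) (b i) + 2 ≤ 8 := by
    have e1 : ∑ i, (contrib 2 (a i) (b i) + if i = j then 2 else 0) ≤
        ∑ i, (2 * a i + 2 * b i) := by
      apply Finset.sum_le_sum
      intro i _
      have := ha' i
      have := hb' i
      by_cases hij : i = j
      · subst hij
        unfold contrib NumCond
        split_ifs <;> omega
      · unfold contrib NumCond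
        split_ifs <;> omega
    rw [Finset.sum_add_distrib, Finset.sum_add_distrib, ← Finset.mul_sum, ← Finset.mul_sum,
      ha, hb] at e1
    simpa using e1
  omega

open Classical in
lemma bad_count {n d : ℕ} (hd : 2 ≤ d) {α β : Fin n →₀ ℕ}
    (hα : α.degree = d) (hβ : β.degree = d) (hpα : ∀ i, α i < d) (hpβ : ∀ i, β i < d)
    (P Q : Fin n → Prop)
    (hP : ∀ i, BadExp d α β (α + Finsupp.single i d) → P i)
    (hQ : ∀ i, BadExp d α β (β + Finsupp.single i d) → Q i) :
    {γ : Fin n →₀ ℕ | γ.degree = 2 * d ∧ BadExp d α β γ}.ncard ≤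
      ∑ i, ((if P i then 1 else 0) + (if Q i then 1 else 0)) := by
  have hsub : {γ : Fin n →₀ ℕ | γ.degree = 2 * d ∧ BadExp d α β γ} ⊆
      (((Finset.univ.filter P).image (fun i => α + Finsupp.single i d) ∪
        (Finset.univ.filter Q).image (fun i => β + Finsupp.single i d) :
          Finset (Fin n →₀ ℕ)) : Set (Fin n →₀ ℕ)) := by
    rintro γ ⟨hdeg, hb⟩
    obtain ⟨i, hi⟩ := exists_big hd hb hdeg
    obtain ⟨δ, rfl⟩ := exists_add_of_le (Finsupp.single_le_iff.mpr hi)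
    have hδ : δ.degree = d := by simp at hdeg; omega
    have hpure : ∀ ε : Fin n →₀ ℕ, (∀ i, ε i < d) → Finsupp.single i d ≠ ε := by
      rintro ε hε rfl
      have := hε i
      simp at this
    simp only [Finset.coe_union, Finset.coe_image, Set.mem_union, Set.mem_image,
      Finset.coe_filter, Finset.mem_univ, true_and, Set.mem_ofPred_eq]
    rcases hb (Finsupp.single i d) δ (by simp) hδ rfl with h | h | h | h
    · exact absurd h (hpure _ hpα)
    · exact absurd h (hpure _ hpβ)
    · subst h
      rw [add_comm] at hb ⊢
      exact Or.inl ⟨i, hP i hb, rfl⟩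
    · subst h
      rw [add_comm] at hb ⊢
      exact Or.inr ⟨i, hQ i hb, rfl⟩
  calc _ ≤ _ := Set.ncard_le_ncard hsub (Finset.finite_toSet _)
    _ = _ := Set.ncard_coe_finset _
    _ ≤ _ := Finset.card_union_le _ _
    _ ≤ _ := Nat.add_le_add Finset.card_image_le Finset.card_image_le
    _ = _ := by
      rw [Finset.sum_add_distrib, Finset.card_filter, Finset.card_filter]

open Classical in
lemma bad_bounds {n d : ℕ} (hd : 2 ≤ d) {α β : Fin n →₀ ℕ}
    (hα : α.degree = d) (hβ : β.degree = d) (hpα : ∀ i, α i < d) (hpβ : ∀ i, β i < d) :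
    (d = 2 → {γ : Fin n →₀ ℕ | γ.degree = 2 * d ∧ BadExp d α β γ}.ncard ≤ 6) ∧
    (d = 3 ∨ d = 4 → {γ : Fin n →₀ ℕ | γ.degree = 2 * d ∧ BadExp d α β γ}.ncard ≤ 4) ∧
    (5 ≤ d → {γ : Fin n →₀ ℕ | γ.degree = 2 * d ∧ BadExp d α β γ}.ncard ≤ 2) := by
  have hA := fun i => analysis hd hα hpα (β := β) i
  have hB := fun i (h : BadExp d α β (β + Finsupp.single i d)) => analysis hd hβ hpβ i h.symm
  have hc := bad_count hd hα hβ hpα hpβ (fun i => NumCond d (α i) (β i))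
    (fun i => NumCond d (β i) (α i)) (fun i h => (hA i h).1) (fun i h => (hB i h).1)
  have sα : ∑ i, α i = d := by rw [← deg_eq_sum, hα]
  have sβ : ∑ i, β i = d := by rw [← deg_eq_sum, hβ]
  refine ⟨?_, fun h => hc.trans (num34 h α β sα sβ hpα hpβ),
    fun h => hc.trans (num5 h α β sα sβ hpα hpβ)⟩
  intro h2
  by_cases hov : ∃ k, 1 ≤ α k ∧ 1 ≤ β k
  · obtain ⟨k, hk1, hk2⟩ := hov
    subst h2
    exact hc.trans (num2a α β sα sβ hpα hpβ k hk1 hk2)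
  · have hc' := bad_count hd hα hβ hpα hpβ (fun i => α i + 1 = d)
      (fun i => β i + 1 = d) (fun i h => (hA i h).2.resolve_right hov)
      (fun i h => (hB i h).2.resolve_right (fun ⟨k, u, v⟩ => hov ⟨k, v, u⟩))
    refine hc'.trans (le_trans (Finset.sum_le_sum (g := fun i => α i + β i) ?_) ?_)
    · intro i _
      split_ifs <;> omega
    · rw [Finset.sum_add_distrib, sα, sβ]
      omega

/-- span of monomials -/
noncomputable def mspan (n : ℕ) (S : Set (Fin n →₀ ℕ)) : Submodule ℂ (PolyR n) :=
  Submodule.span ℂ ((fun α => (monomial α (1 : ℂ) : PolyR n)) '' S)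

lemma finite_deg (n d : ℕ) : {γ : Fin n →₀ ℕ | γ.degree = d}.Finite := by
  refine (Finsupp.finite_of_degree_le d).subset ?_
  intro γ h
  exact le_of_eq h

lemma finrank_mspan (n : ℕ) (S : Set (Fin n →₀ ℕ)) :
    finrank ℂ (mspan n S) = S.ncard := by
  have hli : LinearIndependent ℂ (fun α : Fin n →₀ ℕ => (monomial α (1 : ℂ) : PolyR n)) := by
    have := (basisMonomials (Fin n) ℂ).linearIndependent
    simpa using this
  have h := rank_span (hli.comp ((↑) : S → (Fin n →₀ ℕ)) Subtype.val_injective)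
  rw [Cardinal.mk_range_eq _ (hli.comp ((↑) : S → (Fin n →₀ ℕ)) Subtype.val_injective).injective]
    at h
  unfold mspan
  rw [Set.image_eq_range]
  unfold finrank
  exact congrArg Cardinal.toNat h

lemma formSpace_eq (n d : ℕ) : formSpace n d = mspan n {γ | γ.degree = d} := by
  unfold formSpace mspan
  apply le_antisymm
  · intro p hp
    rw [p.as_sum]
    apply Submodule.sum_mem
    intro v hv
    have : v.degree = d := by
      have := hp (MvPolynomial.mem_support_iff.mp hv)
      rw [← this, Finsupp.degree_eq_weight_one]; rfl
    rw [← mul_one (coeff v p), ← smul_eq_mul, ← smul_monomial]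
    exact Submodule.smul_mem _ _ (Submodule.subset_span ⟨v, this, rfl⟩)
  · rw [Submodule.span_le]
    rintro _ ⟨v, hv, rfl⟩
    exact isHomogeneous_monomial _ hv


lemma mspan_mul (n : ℕ) (S : Set (Fin n →₀ ℕ)) :
    mspan n S * mspan n S = mspan n {γ | ∃ p ∈ S, ∃ q ∈ S, p + q = γ} := by
  unfold mspan
  rw [Submodule.span_mul_span]
  congr 1
  ext f
  constructor
  · rintro ⟨_, ⟨p, hp, rfl⟩, _, ⟨q, hq, rfl⟩, rfl⟩
    exact ⟨p + q, ⟨p, hp, q, hq, rfl⟩, by simp [monomial_mul]⟩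
  · rintro ⟨_, ⟨p, hp, q, hq, rfl⟩, rfl⟩
    exact ⟨_, ⟨p, hp, rfl⟩, _, ⟨q, hq, rfl⟩, by simp [monomial_mul]⟩

lemma vcodim_mspan (n d : ℕ) (S : Set (Fin n →₀ ℕ)) (hS : S ⊆ {γ | γ.degree = d}) :
    vcodim n d (mspan n S) = ({γ | γ.degree = d} \ S).ncard := by
  unfold vcodim
  rw [formSpace_eq, finrank_mspan, finrank_mspan,
    Set.ncard_sdiff hS ((finite_deg n d).subset hS)]

lemma pure_mem (n d : ℕ) (S : Set (Fin n →₀ ℕ)) (hS : S ⊆ {γ | γ.degree = d})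
    (hbpf : IsBPF n (mspan n S)) (i : Fin n) : Finsupp.single i d ∈ S := by
  by_contra hcon
  have h0 : (Pi.single i 1 : Fin n → ℂ) = 0 := by
    apply hbpf
    intro p hp
    induction hp using Submodule.span_induction with
    | mem f hf =>
      obtain ⟨v, hv, rfl⟩ := hf
      have hvd : v.degree = d := hS hv
      have : v i < v.degree := by
        by_contra hlt
        apply hcon
        have hle : Finsupp.single i d ≤ v := Finsupp.single_le_iff.mpr (by omega)
        obtain ⟨w, rfl⟩ := exists_add_of_le hle
        have hw : w.degree = 0 := by simp at hvd; omega
        rw [Finsupp.degree_eq_zero_iff] at hw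
        simpa [hw] using hv
      obtain ⟨k, hk, g, rfl⟩ := exists_other v i this
      simp only [eval_monomial, one_mul]
      rw [Finsupp.prod_fintype _ _ (by simp)]
      apply Finset.prod_eq_zero (Finset.mem_univ k)
      rw [Pi.single_eq_of_ne hk]
      apply zero_pow
      simp
    | zero => simp
    | add f g _ _ hf hg => simp [hf, hg]
    | smul c f _ hf => simp [hf]
  have := congrFun h0 i
  simp at this

theorem stmt4 (n d : ℕ) (hn : 2 ≤ n) (hd : 2 ≤ d)
    (U : Submodule ℂ (PolyR n)) (hU : U ≤ formSpace n d)
    (hmon : IsMonomialSubspace n U) (hbpf : IsBPF n U)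
    (hcodim : vcodim n d U = 2) :
    (d = 2 → vcodim n (2 * d) (U * U) ≤ 6) ∧
    (d = 3 ∨ d = 4 → vcodim n (2 * d) (U * U) ≤ 4) ∧
    (5 ≤ d → vcodim n (2 * d) (U * U) ≤ 2) := by
  obtain ⟨S, hS⟩ := hmon
  change U = mspan n S at hS
  subst hS
  have hSd : S ⊆ {γ | γ.degree = d} := by
    intro v hv
    have h : (monomial v (1 : ℂ) : PolyR n) ∈ formSpace n d :=
      hU (Submodule.subset_span ⟨v, hv, rfl⟩)
    have h' : (monomial v (1 : ℂ) : PolyR n).IsHomogeneous d := h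
    have := h' (d := v) (by simp)
    rw [Set.mem_ofPred_eq, ← this, Finsupp.degree_eq_weight_one]; rfl
  have hpure := pure_mem n d S hSd hbpf
  rw [vcodim_mspan n d S hSd] at hcodim
  obtain ⟨α, β, hαβ, hset⟩ := Set.ncard_eq_two.mp hcodim
  have hα : α ∈ {γ | γ.degree = d} \ S := by rw [hset]; simp
  have hβ : β ∈ {γ | γ.degree = d} \ S := by rw [hset]; simp
  have hlt : ∀ ε ∈ {γ : Fin n →₀ ℕ | γ.degree = d} \ S, ∀ i, ε i < d := by
    rintro ε ⟨hε, hεS⟩ i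
    by_contra hcon
    apply hεS
    have hle : Finsupp.single i d ≤ ε := Finsupp.single_le_iff.mpr (by omega)
    obtain ⟨w, rfl⟩ := exists_add_of_le hle
    have hw : w.degree = 0 := by
      rw [Set.mem_ofPred_eq] at hε
      simp at hε; omega
    rw [Finsupp.degree_eq_zero_iff] at hw
    simpa [hw] using hpure i
  have hb := bad_bounds hd hα.1 hβ.1 (hlt α hα) (hlt β hβ)
  have hmem : ∀ p : Fin n →₀ ℕ, p.degree = d → p ≠ α → p ≠ β → p ∈ S := by
    intro p hp h1 h2
    by_contra h3
    have : p ∈ ({α, β} : Set (Fin n →₀ ℕ)) := by rw [← hset]; exact ⟨hp, h3⟩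
    simp at this
    tauto
  have hcod : vcodim n (2 * d) (mspan n S * mspan n S) ≤
      {γ : Fin n →₀ ℕ | γ.degree = 2 * d ∧ BadExp d α β γ}.ncard := by
    rw [mspan_mul, vcodim_mspan]
    · apply Set.ncard_le_ncard
      · rintro γ ⟨hγ, hγS⟩
        refine ⟨hγ, ?_⟩
        intro p q hp hq hpq
        by_contra hcon
        push Not at hcon
        exact hγS ⟨p, hmem p hp hcon.1 hcon.2.1, q, hmem q hq hcon.2.2.1 hcon.2.2.2, hpq⟩
      · exact (finite_deg n (2 * d)).subset (fun γ h => h.1)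
    · rintro _ ⟨p, hp, q, hq, rfl⟩
      have h1 : p.degree = d := hSd hp
      have h2 : q.degree = d := hSd hq
      rw [Set.mem_ofPred_eq, map_add]; omega
  exact ⟨fun h => hcod.trans (hb.1 h), fun h => hcod.trans (hb.2.1 h),
    fun h => hcod.trans (hb.2.2 h)⟩
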